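/- arXiv:1405.1782 — 12 statements merged into one kernel-verified Lean document; each statement's English description precedes it below -/
import Mathlib

section
/- Let a, b, c, r be nonnegative real numbers. The infimum of a+b+c-α-β-γ over all real triples (α,β,γ) satisfying 0 ≤ α ≤ a, 0 ≤ β ≤ b, 0 ≤ γ ≤ c and min(max(α,γ), max(β,γ)) ≤ r is attained and equals (min(a,b)-r)^+ + (c-r)^+. -/
/-- Full-duplex DMT of the (a,b,c)-relay channel (Lemma 1):
the infimum of a+b+c-α-β-γ over the outage region is attained and
equals (min(a,b)-r)⁺ + (c-r)⁺. -/
theorem fullDuplexDMT (a b c r : ℝ) (ha : 0 ≤ a) (hb : 0 ≤ b) (hc : 0 ≤ c) (hr : 0 ≤ r) :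
    IsLeast {d : ℝ | ∃ α β γ : ℝ, 0 ≤ α ∧ α ≤ a ∧ 0 ≤ β ∧ β ≤ b ∧ 0 ≤ γ ∧ γ ≤ c ∧
        min (max α γ) (max β γ) ≤ r ∧ d = a + b + c - α - β - γ}
      (max (min a b - r) 0 + max (c - r) 0) := by
  constructor
  · have hγ : c - min c r = max (c - r) 0 := by grind
    rcases le_total a b with hab | hab
    · exact ⟨min a r, b, min c r, le_min ha hr, min_le_left _ _, hb, le_rfl, le_min hc hr,
        min_le_left _ _, min_le_of_left_le (max_le (min_le_right _ _) (min_le_right _ _)),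
        by grind⟩
    · exact ⟨a, min b r, min c r, ha, le_rfl, le_min hb hr, min_le_left _ _, le_min hc hr,
        min_le_left _ _, min_le_of_right_le (max_le (min_le_right _ _) (min_le_right _ _)),
        by grind⟩
  · rintro d ⟨α, β, γ, -, hα, -, hβ, -, hγ, h, rfl⟩
    have hγr : max (c - r) 0 ≤ c - γ := by grind
    have hαβ : max (min a b - r) 0 ≤ (a - α) + (b - β) := by grind
    linarith
end

section
/- Let a, b, c, r be nonnegative real numbers. Consider the infimum of a+b+c-α-β-γ over all real triples (α,β,γ) satisfying 0 ≤ α ≤ a, 0 ≤ β ≤ b, 0 ≤ γ ≤ c and min( (1/2)·max(α,γ) + (1/2)·γ , (1/2)·γ + (1/2)·max(β,γ) ) ≤ r. This infimum is attained, and it equals (min(a,b)-r)^+ + (c-r)^+ if c ≥ min(a,b), and it equals (min(a,b)+c-2r)^+ if c < min(a,b). -/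
/-- Both regimes of the DMT of static QMF in a single formula. -/
theorem staticQMF_isLeast {a b c r : ℝ} (ha : 0 ≤ a) (hb : 0 ≤ b) (hc : 0 ≤ c) (hr : 0 ≤ r) :
    IsLeast {d : ℝ | ∃ α β γ : ℝ, 0 ≤ α ∧ α ≤ a ∧ 0 ≤ β ∧ β ≤ b ∧ 0 ≤ γ ∧ γ ≤ c ∧
        min ((1/2) * max α γ + (1/2) * γ) ((1/2) * γ + (1/2) * max β γ) ≤ r ∧
        d = a + b + c - α - β - γ}
      (max (min a b + c - 2 * r) (max (c - r) 0)) := by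
  constructor
  · rcases le_total a b with h | h
    · refine ⟨min a (2 * r - min c r), b, min c r, ?_, min_le_left _ _, hb, le_rfl,
        le_min hc hr, min_le_left _ _, min_le_of_left_le ?_, ?_⟩ <;> grind
    · refine ⟨a, min b (2 * r - min c r), min c r, ha, le_rfl, ?_, min_le_left _ _,
        le_min hc hr, min_le_left _ _, min_le_of_right_le ?_, ?_⟩ <;> grind
  · rintro d ⟨α, β, γ, -, hαa, -, hβb, -, hγc, h, rfl⟩
    have hmin_a := min_le_left a b
    have hmin_b := min_le_right a b
    have hα := le_max_left α γ
    have hαγ := le_max_right α γ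
    have hβ := le_max_left β γ
    have hβγ := le_max_right β γ
    refine max_le ?_ (max_le ?_ ?_) <;> rcases min_le_iff.mp h with h | h <;> linarith

/-- DMT of static QMF with a half-listen half-transmit schedule (Lemma 2). -/
theorem staticQMF_DMT (a b c r : ℝ) (ha : 0 ≤ a) (hb : 0 ≤ b) (hc : 0 ≤ c) (hr : 0 ≤ r) :
    (min a b ≤ c →
      IsLeast {d : ℝ | ∃ α β γ : ℝ, 0 ≤ α ∧ α ≤ a ∧ 0 ≤ β ∧ β ≤ b ∧ 0 ≤ γ ∧ γ ≤ c ∧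
          min ((1/2) * max α γ + (1/2) * γ) ((1/2) * γ + (1/2) * max β γ) ≤ r ∧
          d = a + b + c - α - β - γ}
        (max (min a b - r) 0 + max (c - r) 0)) ∧
    (c < min a b →
      IsLeast {d : ℝ | ∃ α β γ : ℝ, 0 ≤ α ∧ α ≤ a ∧ 0 ≤ β ∧ β ≤ b ∧ 0 ≤ γ ∧ γ ≤ c ∧
          min ((1/2) * max α γ + (1/2) * γ) ((1/2) * γ + (1/2) * max β γ) ≤ r ∧
          d = a + b + c - α - β - γ}
        (max (min a b + c - 2 * r) 0)) := by
  have key := staticQMF_isLeast ha hb hc hr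
  refine ⟨fun h => ?_, fun h => ?_⟩
  · convert key using 1
    grind
  · convert key using 1
    grind
end

section
/- Let a, b, c, r be nonnegative real numbers, and suppose either c ≥ min(a,b), or both c < min(a,b) and r ≤ c. Then the infimum of a+b+c-α-β-γ over real triples (α,β,γ) with 0 ≤ α ≤ a, 0 ≤ β ≤ b, 0 ≤ γ ≤ c and min( (1/2)·max(α,γ)+(1/2)·γ , (1/2)·γ+(1/2)·max(β,γ) ) ≤ r equals the infimum of a+b+c-α-β-γ over real triples (α,β,γ) with 0 ≤ α ≤ a, 0 ≤ β ≤ b, 0 ≤ γ ≤ c and min(max(α,γ), max(β,γ)) ≤ r. -/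
/-- A triple meeting the half-duplex constraint through its first cut is dominated, in sum, by a
triple meeting the full-duplex constraint through its first cut, or meets the full-duplex constraint
itself. -/
theorem exists_fullDuplex_triple_of_cut {a b c r α β γ : ℝ} (hr : 0 ≤ r)
    (hcase : min a b ≤ c ∨ r ≤ c) (hα : 0 ≤ α) (hαa : α ≤ a) (hβ : 0 ≤ β) (hβb : β ≤ b)
    (hγ : 0 ≤ γ) (hγc : γ ≤ c) (h : (1/2) * max α γ + (1/2) * γ ≤ r) :
    ∃ α' β' γ' : ℝ, 0 ≤ α' ∧ α' ≤ a ∧ 0 ≤ β' ∧ β' ≤ b ∧ 0 ≤ γ' ∧ γ' ≤ c ∧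
      min (max α' γ') (max β' γ') ≤ r ∧ α + β + γ ≤ α' + β' + γ' := by
  have h₁ : α ≤ max α γ := le_max_left _ _
  have h₂ : γ ≤ max α γ := le_max_right _ _
  have hγr : γ ≤ r := by linarith
  by_cases hαr : α ≤ r
  · exact ⟨α, β, γ, hα, hαa, hβ, hβb, hγ, hγc, min_le_of_left_le (max_le hαr hγr), le_rfl⟩
  by_cases hrc : r ≤ c
  · exact ⟨r, β, r, hr, by linarith, hβ, hβb, hr, hrc, min_le_of_left_le (by simp),
      by linarith⟩
  · have hβr : β ≤ r := by
      rcases hcase.resolve_right hrc |> min_le_iff.mp with h' | h' <;> linarith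
    exact ⟨α, β, γ, hα, hαa, hβ, hβb, hγ, hγc, min_le_of_right_le (max_le hβr hγr), le_rfl⟩

/-- Static QMF achieves the full-duplex DMT when c ≥ min(a,b), or when
c < min(a,b) and r ≤ c (Corollary 1). -/
theorem staticQMF_achieves_fullDuplex (a b c r : ℝ)
    (ha : 0 ≤ a) (hb : 0 ≤ b) (hc : 0 ≤ c) (hr : 0 ≤ r)
    (hcase : min a b ≤ c ∨ (c < min a b ∧ r ≤ c)) :
    sInf {d : ℝ | ∃ α β γ : ℝ, 0 ≤ α ∧ α ≤ a ∧ 0 ≤ β ∧ β ≤ b ∧ 0 ≤ γ ∧ γ ≤ c ∧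
        min ((1/2) * max α γ + (1/2) * γ) ((1/2) * γ + (1/2) * max β γ) ≤ r ∧
        d = a + b + c - α - β - γ} =
    sInf {d : ℝ | ∃ α β γ : ℝ, 0 ≤ α ∧ α ≤ a ∧ 0 ≤ β ∧ β ≤ b ∧ 0 ≤ γ ∧ γ ≤ c ∧
        min (max α γ) (max β γ) ≤ r ∧ d = a + b + c - α - β - γ} := by
  have hcase' : min a b ≤ c ∨ r ≤ c := hcase.imp_right And.right
  apply le_antisymm
  · refine le_csInf ⟨_, 0, 0, 0, le_rfl, ha, le_rfl, hb, le_rfl, hc, by simpa using hr, rfl⟩ ?_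
    rintro d ⟨α, β, γ, hα, hαa, hβ, hβb, hγ, hγc, h, rfl⟩
    refine csInf_le ⟨0, ?_⟩
      ⟨α, β, γ, hα, hαa, hβ, hβb, hγ, hγc, (min_le_min ?_ ?_).trans h, rfl⟩
    · rintro _ ⟨α, β, γ, -, hαa, -, hβb, -, hγc, -, rfl⟩
      linarith
    · linarith [le_max_right α γ]
    · linarith [le_max_right β γ]
  · refine le_csInf ⟨_, 0, 0, 0, le_rfl, ha, le_rfl, hb, le_rfl, hc, by simpa using hr, rfl⟩ ?_
    rintro d ⟨α, β, γ, hα, hαa, hβ, hβb, hγ, hγc, h, rfl⟩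
    obtain ⟨α', β', γ', hα', hαa', hβ', hβb', hγ', hγc', h', hsum⟩ :
        ∃ α' β' γ' : ℝ, 0 ≤ α' ∧ α' ≤ a ∧ 0 ≤ β' ∧ β' ≤ b ∧ 0 ≤ γ' ∧ γ' ≤ c ∧
          min (max α' γ') (max β' γ') ≤ r ∧ α + β + γ ≤ α' + β' + γ' := by
      rcases min_le_iff.mp h with h | h
      · exact exists_fullDuplex_triple_of_cut hr hcase' hα hαa hβ hβb hγ hγc h
      · obtain ⟨β', α', γ', hβ', hβb', hα', hαa', hγ', hγc', h', hsum⟩ :=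
          exists_fullDuplex_triple_of_cut hr (min_comm a b ▸ hcase') hβ hβb hα hαa hγ hγc
            (by linarith)
        exact ⟨α', β', γ', hα', hαa', hβ', hβb', hγ', hγc', min_comm (max β' γ') _ ▸ h',
          by linarith⟩
    refine csInf_le_of_le ⟨0, ?_⟩
      ⟨α', β', γ', hα', hαa', hβ', hβb', hγ', hγc', h', rfl⟩ (by linarith)
    rintro _ ⟨α, β, γ, -, hαa, -, hβb, -, hγc, -, rfl⟩
    linarith
end

section
/- Let a, b, c, r be real numbers with 0 ≤ c < min(a,b) and r ≥ 0, and set M = max(a,b), m = min(a,b). Let O be the set of real triples (α,β,γ) with 0 ≤ α ≤ a, 0 ≤ β ≤ b, 0 ≤ γ ≤ c such that either (α ≤ r and γ ≤ r), or (r ≤ α and (r/α)·γ + (1 - r/α)·max(β,γ) ≤ r). Define D(r) = m + c - 2r if 0 ≤ r ≤ min(c, M/2); D(r) = m - (M-c)·r/(M-r) if c < r < M/2; and D(r) = (a·b/r - a - b + c)^+ if r ≥ M/2 (and r > 0). Then the infimum of a+b+c-α-β-γ over (α,β,γ) ∈ O equals max(D(r), 0). -/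
/-- Clearing the denominator in the combined-cut condition when the relay-to-destination exponent
dominates the direct one. -/
lemma combined_cut_le {r α β γ : ℝ} (hα : 0 < α) (hγβ : γ ≤ β)
    (h : r * γ + (α - r) * β ≤ r * α) :
    (r / α) * γ + (1 - r / α) * max β γ ≤ r := by
  rw [max_eq_left hγβ]
  have e : (r / α) * γ + (1 - r / α) * β = (r * γ + (α - r) * β) / α := by
    field_simp
  rwa [e, div_le_iff₀ hα]

/-- The combined-cut condition bounds the direct exponent and the product of the excess
exponents. -/
lemma combined_cut_bounds {r α β γ : ℝ} (hr : 0 ≤ r) (hα : r ≤ α)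
    (h : (r / α) * γ + (1 - r / α) * max β γ ≤ r) :
    γ ≤ r ∧ (α - r) * (max β γ - r) ≤ r * (r - γ) := by
  have hα0 : 0 ≤ α := hr.trans hα
  have ht : r / α ≤ 1 := div_le_one_of_le₀ hα hα0
  have hs : γ ≤ max β γ := le_max_right _ _
  refine ⟨by nlinarith [mul_nonneg (sub_nonneg.2 ht) (sub_nonneg.2 hs)], ?_⟩
  rcases hα0.eq_or_lt with rfl | hpos
  · obtain rfl : r = 0 := le_antisymm hα hr
    simp
  · have e : (r / α) * γ + (1 - r / α) * max β γ = (r * γ + (α - r) * max β γ) / α := by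
      field_simp
    rw [e, div_le_iff₀ hpos] at h
    linarith

/-- If `x, u ≤ B` and `x * u ≤ r * (r - γ)` with `r ≤ B`, the sum `x + u + γ` is largest at the
corner where one of `x`, `u` equals `B` and `γ` is maximal. -/
lemma add_le_of_mul_le {x u γ g r B : ℝ} (hB : 0 < B) (hrB : r ≤ B) (hx : x ≤ B) (hu : u ≤ B)
    (hγ : γ ≤ g) (h : x * u ≤ r * (r - γ)) :
    x + u + γ ≤ B + g + r * (r - g) / B := by
  have e : B + g + r * (r - g) / B = (B * B + g * B + r * (r - g)) / B := by
    field_simp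
  rw [e, le_div_iff₀ hB]
  nlinarith [mul_nonneg (sub_nonneg.2 hx) (sub_nonneg.2 hu),
    mul_nonneg (sub_nonneg.2 hrB) (sub_nonneg.2 hγ)]

/-- DMT achieved by dynamic decode-and-forward (Lemma 3). -/
theorem DDF_DMT (a b c r : ℝ) (hc0 : 0 ≤ c) (hc : c < min a b) (hr : 0 ≤ r) :
    sInf {d : ℝ | ∃ α β γ : ℝ, 0 ≤ α ∧ α ≤ a ∧ 0 ≤ β ∧ β ≤ b ∧ 0 ≤ γ ∧ γ ≤ c ∧
        ((α ≤ r ∧ γ ≤ r) ∨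
          (r ≤ α ∧ (r / α) * γ + (1 - r / α) * max β γ ≤ r)) ∧
        d = a + b + c - α - β - γ} =
    max (if r ≤ min c (max a b / 2) then min a b + c - 2 * r
          else if r < max a b / 2 then
            min a b - (max a b - c) * r / (max a b - r)
          else max (a * b / r - a - b + c) 0) 0 := by
  have hca : c < a := hc.trans_le (min_le_left _ _)
  have hcb : c < b := hc.trans_le (min_le_right _ _)
  have ha : 0 < a := hc0.trans_lt hca
  have hb : 0 < b := hc0.trans_lt hcb
  have haM : a ≤ max a b := le_max_left _ _
  have hbM : b ≤ max a b := le_max_right _ _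
  have hsum : min a b + max a b = a + b := min_add_max a b
  apply IsLeast.csInf_eq
  constructor
  · split_ifs with h1 h2
    · obtain ⟨hrc, hrM⟩ := le_min_iff.1 h1
      rw [max_eq_left (by linarith)]
      rcases le_total a b with hab | hab
      · refine ⟨r, b, r, hr, by linarith, hb.le, le_rfl, hr, hrc, .inl ⟨le_rfl, le_rfl⟩, ?_⟩
        rw [min_eq_left hab]; ring
      · refine ⟨a, r, r, ha.le, le_rfl, hr, by linarith, hr, hrc,
          .inr ⟨by linarith, combined_cut_le ha le_rfl (by linarith)⟩, ?_⟩
        rw [min_eq_right hab]; ring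
    · have hcr : c < r := by
        by_contra! hrc
        exact h1 (le_min hrc h2.le)
      set M := max a b with hM
      have hMr : 0 < M - r := by linarith
      set p := (M - c) * r / (M - r) with hp
      have hpmul : p * (M - r) = (M - c) * r := div_mul_cancel₀ _ hMr.ne'
      have hrp : r ≤ p := by
        rw [hp, le_div_iff₀ hMr]
        nlinarith
      have hval : max (min a b - p) 0 = min a b - min (min a b) p := by
        rcases le_total (min a b) p with h | h
        · rw [min_eq_left h, max_eq_right (by linarith)]; ring
        · rw [min_eq_right h, max_eq_left (by linarith)]
      rw [hval]
      rcases le_total a b with hab | hab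
      · rw [max_eq_right hab] at hM
        rw [hM] at hpmul hMr
        rw [min_eq_left hab]
        refine ⟨min a p, b, c, le_min ha.le (hr.trans hrp), min_le_left _ _, hb.le, le_rfl, hc0,
          le_rfl, ?_, by ring⟩
        rcases le_total (min a p) r with h | h
        · exact .inl ⟨h, hcr.le⟩
        · refine .inr ⟨h, combined_cut_le (by linarith) hcb.le ?_⟩
          have := mul_le_mul_of_nonneg_right (min_le_right a p) hMr.le
          linarith
      · rw [max_eq_left hab] at hM
        rw [hM] at hpmul hMr
        rw [min_eq_right hab]
        refine ⟨a, min b p, c, ha.le, le_rfl, le_min hb.le (hr.trans hrp), min_le_left _ _, hc0,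
          le_rfl, .inr ⟨by linarith, combined_cut_le ha (le_min hcb.le (by linarith)) ?_⟩,
          by ring⟩
        have := mul_le_mul_of_nonneg_right (min_le_right b p) hMr.le
        linarith
    · push Not at h2
      have hr0 : 0 < r := by linarith
      set q := a * b / r with hq
      have hqmul : q * r = a * b := div_mul_cancel₀ _ hr0.ne'
      rw [max_eq_left (le_max_right _ _)]
      rcases lt_or_ge a r with har | har
      · have hqb : q ≤ b := by
          rw [hq, div_le_iff₀ hr0]
          nlinarith
        rw [max_eq_right (by linarith)]
        exact ⟨a, b, c, ha.le, le_rfl, hb.le, le_rfl, hc0, le_rfl,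
          .inl ⟨har.le, by linarith⟩, by ring⟩
      · have hqab : q ≤ a + b := by
          rw [hq, div_le_iff₀ hr0]
          nlinarith
        refine ⟨a, b, min c (a + b - q), ha.le, le_rfl, hb.le, le_rfl,
          le_min hc0 (by linarith), min_le_left _ _,
          .inr ⟨har, combined_cut_le ha ((min_le_left _ _).trans hcb.le) ?_⟩, ?_⟩
        · have := mul_le_mul_of_nonneg_left (min_le_right c (a + b - q)) hr
          linarith
        · rcases le_total c (a + b - q) with h | h
          · rw [min_eq_left h, max_eq_right (by linarith)]; ring
          · rw [min_eq_right h, max_eq_left (by linarith)]; ring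
  · rintro d ⟨α, β, γ, hα0, hα, hβ0, hβ, hγ0, hγ, hO, rfl⟩
    have hd : 0 ≤ a + b + c - α - β - γ := by linarith
    refine max_le ?_ hd
    have hβs : β ≤ max β γ := le_max_left _ _
    have hsb : max β γ ≤ b := max_le hβ (by linarith)
    split_ifs with h1 h2
    · obtain ⟨hrc, hrM⟩ := le_min_iff.1 h1
      rcases hO with ⟨h, h'⟩ | ⟨hrα, h⟩
      · linarith [min_le_left a b]
      · obtain ⟨hγr, hmul⟩ := combined_cut_bounds hr hrα h
        have hM : 0 < max a b - r := by linarith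
        have := add_le_of_mul_le hM (by linarith) (by linarith) (by linarith) hγr hmul
        rw [sub_self, mul_zero, zero_div] at this
        linarith
    · have hcr : c < r := by
        by_contra! hrc
        exact h1 (le_min hrc h2.le)
      have hM : 0 < max a b - r := by linarith
      have e : (max a b - c) * r / (max a b - r) = r + r * (r - c) / (max a b - r) := by
        field_simp
        ring
      rw [e]
      rcases hO with ⟨h, h'⟩ | ⟨hrα, h⟩
      · have : 0 ≤ r * (r - c) / (max a b - r) :=
          div_nonneg (mul_nonneg hr (by linarith)) hM.le
        linarith [min_le_left a b]
      · obtain ⟨-, hmul⟩ := combined_cut_bounds hr hrα h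
        have := add_le_of_mul_le hM (by linarith) (by linarith) (by linarith) hγ hmul
        linarith
    · push Not at h2
      have hr0 : 0 < r := by linarith
      refine max_le ?_ hd
      suffices a * b / r ≤ 2 * a + 2 * b - α - β - γ by linarith
      rw [div_le_iff₀ hr0]
      have har : 0 ≤ 2 * r - a := by linarith
      have hbr : 0 ≤ 2 * r - b := by linarith
      rcases hO with ⟨h, h'⟩ | ⟨hrα, h⟩
      · rcases le_total a r with har' | har'
        · have : a * b ≤ r * b := mul_le_mul_of_nonneg_right har' hb.le
          nlinarith
        · nlinarith [mul_nonneg (sub_nonneg.2 har') hbr]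
      · obtain ⟨-, hmul⟩ := combined_cut_bounds hr hrα h
        nlinarith [mul_nonneg (sub_nonneg.2 hα) (sub_nonneg.2 hsb),
          mul_nonneg har (sub_nonneg.2 hsb), mul_nonneg hbr (sub_nonneg.2 hα)]
end

section
/- Let p, c, r be real numbers with 0 ≤ c < p and p/2 ≤ r ≤ (p+c)/2. Let O(r) be the set of real triples (α,β,γ) with 0 ≤ α ≤ p, 0 ≤ β ≤ p, 0 ≤ γ ≤ c, γ < min(α,β), and (α·β - γ²)/(α + β - 2γ) ≤ r. Then the triple (p, p, 2r-p) belongs to O(r), and consequently the infimum of 2p + c - α - β - γ over (α,β,γ) ∈ O(r) is at most p + c - 2r. -/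
/-- Static QMF is optimal for p/2 ≤ r ≤ (p+c)/2 when c < a = b = p: the point
(p, p, 2r-p) is in the global-CSI outage region, so the global-CSI DMT is at
most p + c - 2r (Lemma 5 / Lemma "abstatqmf"). -/
theorem globalCSI_upper_bound (p c r : ℝ) (hc0 : 0 ≤ c) (hcp : c < p)
    (hr1 : p / 2 ≤ r) (hr2 : r ≤ (p + c) / 2) :
    ((0:ℝ) ≤ p ∧ p ≤ p ∧ (0:ℝ) ≤ p ∧ p ≤ p ∧ 0 ≤ 2 * r - p ∧ 2 * r - p ≤ c ∧
      2 * r - p < min p p ∧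
      (p * p - (2 * r - p) ^ 2) / (p + p - 2 * (2 * r - p)) ≤ r) ∧
    sInf {d : ℝ | ∃ α β γ : ℝ, 0 ≤ α ∧ α ≤ p ∧ 0 ≤ β ∧ β ≤ p ∧ 0 ≤ γ ∧ γ ≤ c ∧
        γ < min α β ∧ (α * β - γ ^ 2) / (α + β - 2 * γ) ≤ r ∧
        d = 2 * p + c - α - β - γ} ≤ p + c - 2 * r := by
  have hrp : r < p := by linarith
  have hγ : 2 * r - p < min p p := by rw [min_self]; linarith
  have hrate : (p * p - (2 * r - p) ^ 2) / (p + p - 2 * (2 * r - p)) ≤ r := by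
    rw [div_le_iff₀ (by linarith)]
    exact le_of_eq (by ring)
  have hmem : (0:ℝ) ≤ p ∧ p ≤ p ∧ (0:ℝ) ≤ p ∧ p ≤ p ∧ 0 ≤ 2 * r - p ∧ 2 * r - p ≤ c ∧
      2 * r - p < min p p ∧
      (p * p - (2 * r - p) ^ 2) / (p + p - 2 * (2 * r - p)) ≤ r :=
    ⟨by linarith, le_rfl, by linarith, le_rfl, by linarith, by linarith, hγ, hrate⟩
  refine ⟨hmem, csInf_le ⟨0, ?_⟩ ?_⟩
  · rintro d ⟨α, β, γ, -, hα, -, hβ, -, hγc, -, -, rfl⟩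
    linarith
  · obtain ⟨h1, h2, h3, h4, h5, h6, h7, h8⟩ := hmem
    exact ⟨p, p, 2 * r - p, h1, h2, h3, h4, h5, h6, h7, h8, by ring⟩
end

section
/- Let p, c, r be real numbers with 0 ≤ c < r < p/2. Then for every t ∈ [0,1], the infimum of p + c - β - γ over all pairs (β,γ) of reals with 0 ≤ β ≤ p, 0 ≤ γ ≤ c and min( t·p + (1-t)·γ , t·γ + (1-t)·max(β,γ) ) ≤ r is at most p - (p-c)·r/(p-r). -/
/-- Key step in the receive-CSI upper bound (Lemma 6): with α = p fixed, for any
listen fraction t there are adversarial (β,γ) giving diversity at most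
p - (p-c)r/(p-r). -/
theorem receiveCSI_upper_bound (p c r : ℝ) (hc0 : 0 ≤ c) (hcr : c < r)
    (hrp : r < p / 2) :
    ∀ t : ℝ, 0 ≤ t → t ≤ 1 →
      sInf {d : ℝ | ∃ β γ : ℝ, 0 ≤ β ∧ β ≤ p ∧ 0 ≤ γ ∧ γ ≤ c ∧
          min (t * p + (1 - t) * γ) (t * γ + (1 - t) * max β γ) ≤ r ∧
          d = p + c - β - γ} ≤ p - (p - c) * r / (p - r) := by
  intro t ht0 ht1
  have hpr : 0 < p - r := by linarith
  obtain ⟨b, hb⟩ : ∃ b, b = (p - c) * r / (p - r) := ⟨_, rfl⟩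
  have hbm : b * (p - r) = (p - c) * r := by rw [hb]; field_simp
  have hb_le : b ≤ p - c := by
    rw [hb, div_le_iff₀ hpr]
    exact mul_le_mul_of_nonneg_left (by linarith) (by linarith)
  have hcb : c ≤ b := by
    rw [hb, le_div_iff₀ hpr]
    nlinarith
  rw [← hb]
  have hbdd : BddBelow {d : ℝ | ∃ β γ : ℝ, 0 ≤ β ∧ β ≤ p ∧ 0 ≤ γ ∧ γ ≤ c ∧
      min (t * p + (1 - t) * γ) (t * γ + (1 - t) * max β γ) ≤ r ∧
      d = p + c - β - γ} := by
    refine ⟨0, ?_⟩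
    rintro d ⟨β, γ, -, hβ, -, hγ, -, rfl⟩
    linarith
  rcases le_total (t * p) r with h | h
  · refine csInf_le_of_le hbdd (b := c) ⟨p, 0, by linarith, le_rfl, le_rfl, hc0, ?_, by ring⟩
      (by linarith)
    exact min_le_of_left_le (by linarith)
  · refine csInf_le_of_le hbdd (b := p - b)
      ⟨b, c, by linarith, by linarith, hc0, le_rfl, ?_, by ring⟩ le_rfl
    refine min_le_of_right_le ?_
    rw [max_eq_left hcb]
    refine le_of_mul_le_mul_right ?_ hpr
    have key : (t * c + (1 - t) * b) * (p - r) = r * (p - r) - (t * p - r) * (r - c) := by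
      linear_combination (1 - t) * hbm
    have := mul_nonneg (sub_nonneg.2 h) (sub_nonneg.2 hcr.le)
    linarith
end

section
/- Let r be a real number with 0 ≤ r < 1/2. The infimum of 4 - α - β - γ - δ over all quadruples (α,β,γ,δ) ∈ [0,1]^4 satisfying α·β/(α+β) + γ·δ/(γ+δ) ≤ r (with the convention that a fraction with zero denominator equals 0) is attained and equals 2 - r/(1-r). -/
/-- On the unit square, `α + β` exceeds `1` by at most `s / (1 - r)`, where
`s = α * β / (α + β)` and `s ≤ r < 1`. -/
lemma add_le_one_add_mul_div_add_div {α β r : ℝ} (hα0 : 0 ≤ α) (hα1 : α ≤ 1) (hβ0 : 0 ≤ β)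
    (hβ1 : β ≤ 1) (hr : r < 1) (hs : α * β / (α + β) ≤ r) :
    α + β ≤ 1 + α * β / (α + β) / (1 - r) := by
  have hs0 : 0 ≤ α * β / (α + β) := by positivity
  have h : (1 - α * β / (α + β)) * (α + β) ≤ 1 := by
    rcases eq_or_ne (α + β) 0 with h0 | h0
    · simp [h0]
    · have : α * β / (α + β) * (α + β) = α * β := div_mul_cancel₀ _ h0
      nlinarith [mul_nonneg (sub_nonneg.2 hα1) (sub_nonneg.2 hβ1)]
  generalize α * β / (α + β) = s at *
  have hr' : 0 < 1 - r := by linarith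
  rcases le_total (α + β) 1 with hS | hS
  · have : 0 ≤ s / (1 - r) := by positivity
    linarith
  · rw [← sub_le_iff_le_add', le_div_iff₀ hr']
    nlinarith


/-- Global-CSI DMT of the parallel relay network for 0 ≤ r < 1/2
(Lemmas 7–9, first part of Theorem 2). Division by zero is zero in Lean,
matching the convention that a fraction with zero denominator equals 0. -/
theorem globalCSI_parallel_DMT (r : ℝ) (hr0 : 0 ≤ r) (hr1 : r < 1 / 2) :
    IsLeast {d : ℝ | ∃ α β γ δ : ℝ,
        0 ≤ α ∧ α ≤ 1 ∧ 0 ≤ β ∧ β ≤ 1 ∧ 0 ≤ γ ∧ γ ≤ 1 ∧ 0 ≤ δ ∧ δ ≤ 1 ∧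
        α * β / (α + β) + γ * δ / (γ + δ) ≤ r ∧
        d = 4 - α - β - γ - δ}
      (2 - r / (1 - r)) := by
  have hr' : 0 < 1 - r := by linarith
  constructor
  · refine ⟨1, r / (1 - r), 1, 0, zero_le_one, le_rfl, by positivity, ?_, zero_le_one, le_rfl,
      le_rfl, zero_le_one, ?_, by ring⟩
    · rw [div_le_one hr']
      linarith
    · have h : 1 + r / (1 - r) = 1 / (1 - r) := by
        field_simp
        ring
      rw [h, mul_zero, zero_div, add_zero, one_mul, div_div_div_cancel_right₀ hr'.ne', div_one]
  · rintro d ⟨α, β, γ, δ, hα0, hα1, hβ0, hβ1, hγ0, hγ1, hδ0, hδ1, h, rfl⟩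
    have hs : 0 ≤ α * β / (α + β) := by positivity
    have ht : 0 ≤ γ * δ / (γ + δ) := by positivity
    have h₁ := add_le_one_add_mul_div_add_div hα0 hα1 hβ0 hβ1 (by linarith)
      (show α * β / (α + β) ≤ r by linarith)
    have h₂ := add_le_one_add_mul_div_add_div hγ0 hγ1 hδ0 hδ1 (by linarith)
      (show γ * δ / (γ + δ) ≤ r by linarith)
    have h₃ := div_le_div_of_nonneg_right h hr'.le
    rw [add_div] at h₃
    linarith
end

section
/- Let r ∈ [0,1] and t₁, t₂ ∈ [0,1] be real numbers. Then the infimum of 4 - α - β - γ - δ over all quadruples (α,β,γ,δ) ∈ [0,1]^4 satisfying min(t₁·α, (1-t₁)·β) + min(t₂·γ, (1-t₂)·δ) ≤ r is at most 2 - 2r. -/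
/-- For every listen fraction `t`, a relay path whose two link exponents sum to `1 + r` can have
rate exponent at most `r / 2`: degrade to `r` the link that is allotted at most half the time. -/
theorem exists_link_exponents_min_le_half (r t : ℝ) (hr0 : 0 ≤ r) (hr1 : r ≤ 1) :
    ∃ α β : ℝ, 0 ≤ α ∧ α ≤ 1 ∧ 0 ≤ β ∧ β ≤ 1 ∧
      min (t * α) ((1 - t) * β) ≤ r / 2 ∧ α + β = 1 + r := by
  rcases le_total t (1 / 2) with ht | ht
  · exact ⟨r, 1, hr0, hr1, zero_le_one, le_rfl, (min_le_left _ _).trans (by nlinarith), by ring⟩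
  · exact ⟨1, r, zero_le_one, le_rfl, hr0, hr1, (min_le_right _ _).trans (by nlinarith), by ring⟩

/-- No static QMF schedule on the parallel relay network beats diversity 2-2r
(proof of Lemma 9). -/
theorem staticQMF_parallel_upper_bound (r t₁ t₂ : ℝ)
    (hr0 : 0 ≤ r) (hr1 : r ≤ 1) (ht₁0 : 0 ≤ t₁) (ht₁1 : t₁ ≤ 1)
    (ht₂0 : 0 ≤ t₂) (ht₂1 : t₂ ≤ 1) :
    sInf {d : ℝ | ∃ α β γ δ : ℝ,
        0 ≤ α ∧ α ≤ 1 ∧ 0 ≤ β ∧ β ≤ 1 ∧ 0 ≤ γ ∧ γ ≤ 1 ∧ 0 ≤ δ ∧ δ ≤ 1 ∧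
        min (t₁ * α) ((1 - t₁) * β) + min (t₂ * γ) ((1 - t₂) * δ) ≤ r ∧
        d = 4 - α - β - γ - δ} ≤ 2 - 2 * r := by
  obtain ⟨α, β, hα0, hα1, hβ0, hβ1, hαβ, hsum₁⟩ :=
    exists_link_exponents_min_le_half r t₁ hr0 hr1
  obtain ⟨γ, δ, hγ0, hγ1, hδ0, hδ1, hγδ, hsum₂⟩ :=
    exists_link_exponents_min_le_half r t₂ hr0 hr1
  refine csInf_le ⟨0, ?_⟩
    ⟨α, β, γ, δ, hα0, hα1, hβ0, hβ1, hγ0, hγ1, hδ0, hδ1, by linarith, by linarith⟩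
  rintro _ ⟨α', β', γ', δ', -, hα', -, hβ', -, hγ', -, hδ', -, rfl⟩
  linarith
end

section
/- Let r be a real number with 1/2 ≤ r ≤ 1 and let t ∈ [0,1]. Then there exist β, δ ∈ [0,1] such that β + δ ≥ 2r and min( t , (1-t)·β ) + min( t , (1-t)·δ ) ≤ r. -/
/-- Key step of Lemma 10: for every listen fraction t there exist outage
realizations (β,δ) with β + δ ≥ 2r. -/
theorem receiveCSI_parallel_outage (r t : ℝ) (hr0 : 1 / 2 ≤ r) (hr1 : r ≤ 1)
    (ht0 : 0 ≤ t) (ht1 : t ≤ 1) :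
    ∃ β δ : ℝ, 0 ≤ β ∧ β ≤ 1 ∧ 0 ≤ δ ∧ δ ≤ 1 ∧ 2 * r ≤ β + δ ∧
      min t ((1 - t) * β) + min t ((1 - t) * δ) ≤ r := by
  rcases le_total t (1 / 2) with h | h
  · refine ⟨1, 2 * r - 1, by norm_num, le_rfl, by linarith, by linarith, by linarith, ?_⟩
    have h1 := min_le_left t ((1 - t) * 1)
    have h2 := min_le_right t ((1 - t) * (2 * r - 1))
    nlinarith [mul_nonneg (sub_nonneg.2 h) (sub_nonneg.2 hr1)]
  · refine ⟨r, r, by linarith, hr1, by linarith, hr1, by linarith, ?_⟩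
    have h1 := min_le_right t ((1 - t) * r)
    have hr : 0 ≤ r := by linarith
    nlinarith [mul_nonneg (sub_nonneg.2 h) hr]
end

section
/- Let r be a real number with 0 ≤ r ≤ 1/2. The infimum of 4 - α - β - γ - δ over all quadruples (α,β,γ,δ) ∈ [0,1]^4 satisfying α·β + γ·δ ≤ r/(1-r), α + β ≤ 1/(1-r), and γ + δ ≤ 1/(1-r) is attained and equals 2 - r/(1-r). -/
/-- Case (i) of the dynamic QMF DMT computation for the parallel relay
network (proof of Lemma 8). -/
theorem dynamicQMF_parallel_case_i (r : ℝ) (hr0 : 0 ≤ r) (hr1 : r ≤ 1 / 2) :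
    IsLeast {d : ℝ | ∃ α β γ δ : ℝ,
        0 ≤ α ∧ α ≤ 1 ∧ 0 ≤ β ∧ β ≤ 1 ∧ 0 ≤ γ ∧ γ ≤ 1 ∧ 0 ≤ δ ∧ δ ≤ 1 ∧
        α * β + γ * δ ≤ r / (1 - r) ∧ α + β ≤ 1 / (1 - r) ∧ γ + δ ≤ 1 / (1 - r) ∧
        d = 4 - α - β - γ - δ}
      (2 - r / (1 - r)) := by
  have hpos : 0 < 1 - r := by linarith
  have hc0 : 0 ≤ r / (1 - r) := div_nonneg hr0 hpos.le
  have hc1 : r / (1 - r) ≤ 1 := (div_le_one hpos).2 (by linarith)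
  have hc : 1 / (1 - r) = 1 + r / (1 - r) := by
    field_simp
    ring
  rw [hc]
  constructor
  · refine ⟨1, r / (1 - r), 1, 0, ?_⟩
    refine ⟨?_, ?_, ?_, ?_, ?_, ?_, ?_, ?_, ?_, ?_, ?_, ?_⟩ <;> linarith
  · rintro d ⟨α, β, γ, δ, -, hα, -, hβ, -, hγ, -, hδ, h, -, -, rfl⟩
    have hαβ := mul_nonneg (sub_nonneg.2 hα) (sub_nonneg.2 hβ)
    have hγδ := mul_nonneg (sub_nonneg.2 hγ) (sub_nonneg.2 hδ)
    linarith
end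

section
/- Let r be a real number with 1/2 ≤ r ≤ 1 and let f : [0,1] → [0,1] be an arbitrary function. Then the infimum of 4 - α - β - γ - δ over all quadruples (α,β,γ,δ) ∈ [0,1]^4 satisfying min( f(α)·α , (1-f(α))·β ) + min( f(γ)·γ , (1-f(γ))·δ ) ≤ r is at most 2 - 2r. -/
/-- Lemma 10: for every receive-CSI scheduling rule f, the DMT of the parallel
relay network is at most 2 - 2r when 1/2 ≤ r ≤ 1. -/
theorem receiveCSI_parallel_upper_bound (r : ℝ) (hr0 : 1 / 2 ≤ r) (hr1 : r ≤ 1)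
    (f : ℝ → ℝ) (hf : ∀ x, 0 ≤ x → x ≤ 1 → 0 ≤ f x ∧ f x ≤ 1) :
    sInf {d : ℝ | ∃ α β γ δ : ℝ,
        0 ≤ α ∧ α ≤ 1 ∧ 0 ≤ β ∧ β ≤ 1 ∧ 0 ≤ γ ∧ γ ≤ 1 ∧ 0 ≤ δ ∧ δ ≤ 1 ∧
        min (f α * α) ((1 - f α) * β) + min (f γ * γ) ((1 - f γ) * δ) ≤ r ∧
        d = 4 - α - β - γ - δ} ≤ 2 - 2 * r := by
  refine csInf_le ⟨0, ?_⟩ ?_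
  · rintro d ⟨α, β, γ, δ, -, hα, -, hβ, -, hγ, -, hδ, -, rfl⟩
    linarith
  · rcases le_total (1 / 2) (f 1) with h | h
    · refine ⟨1, r, 1, r, zero_le_one, le_rfl, by linarith, hr1, zero_le_one, le_rfl,
        by linarith, hr1, ?_, by ring⟩
      have := min_le_right (f 1 * 1) ((1 - f 1) * r)
      nlinarith
    · refine ⟨1, 1, 1, 2 * r - 1, zero_le_one, le_rfl, zero_le_one, le_rfl, zero_le_one, le_rfl,
        by linarith, by linarith, ?_, by ring⟩
      have hl := min_le_left (f 1 * 1) ((1 - f 1) * 1)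
      have hr := min_le_right (f 1 * 1) ((1 - f 1) * (2 * r - 1))
      nlinarith
end

section
/- Let r be a real number with 0 ≤ r < 1/2. Define W(r) = inf over (α,γ) ∈ [0,1]² of ( sup over (t₁,t₂) ∈ [0,1]² of ( inf over pairs (β,δ) ∈ [0,1]² satisfying min(t₁·α, (1-t₁)·β) + min(t₂·γ, (1-t₂)·δ) ≤ r of (4 - α - β - γ - δ) ) ). Then W(r) = 2 - r/(1-r). -/
/-- With listen fraction `1 - a * s`, a relay path carrying less than `1 - s` carries at least
`s * (a + b - 1)`. -/
theorem mul_add_sub_one_le_min {s a b : ℝ} (hs : 0 ≤ s) (ha0 : 0 ≤ a) (ha1 : a ≤ 1) (hb1 : b ≤ 1)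
    (h : min ((1 - a * s) * a) ((1 - (1 - a * s)) * b) < 1 - s) :
    s * (a + b - 1) ≤ min ((1 - a * s) * a) ((1 - (1 - a * s)) * b) := by
  have hab : 0 ≤ s * ((1 - a) * (1 - b)) :=
    mul_nonneg hs (mul_nonneg (sub_nonneg.2 ha1) (sub_nonneg.2 hb1))
  refine le_min ?_ (by linarith)
  by_cases hsa : s * a ≤ 1 - s
  · nlinarith [mul_nonneg ha0 (sub_nonneg.2 hsa), mul_nonneg hs (sub_nonneg.2 hb1)]
  · have hprod := mul_nonneg (sub_nonneg.2 ha1) (sub_nonneg.2 (not_le.1 hsa).le)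
    rcases min_lt_iff.1 h with h | h <;> linarith

theorem min_listen_nonneg {a b t : ℝ} (ha : 0 ≤ a) (hb : 0 ≤ b) (ht0 : 0 ≤ t) (ht1 : t ≤ 1) :
    0 ≤ min (t * a) ((1 - t) * b) :=
  le_min (mul_nonneg ht0 ha) (mul_nonneg (sub_nonneg.2 ht1) hb)

/-- In outage under the schedule `1 - α * s`, `1 - γ * s` with `s < 1 - r`, the sum of the
exponents is at most `2 + r / s`. -/
theorem two_sub_div_le_of_outage {r s α β γ δ : ℝ} (hs : 0 < s) (hs1 : s ≤ 1) (hrs : s < 1 - r)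
    (hα0 : 0 ≤ α) (hα1 : α ≤ 1) (hγ0 : 0 ≤ γ) (hγ1 : γ ≤ 1)
    (hβ0 : 0 ≤ β) (hβ1 : β ≤ 1) (hδ0 : 0 ≤ δ) (hδ1 : δ ≤ 1)
    (h : min ((1 - α * s) * α) ((1 - (1 - α * s)) * β) +
      min ((1 - γ * s) * γ) ((1 - (1 - γ * s)) * δ) ≤ r) :
    2 - r / s ≤ 4 - α - β - γ - δ := by
  have n₁ := min_listen_nonneg (t := 1 - α * s) hα0 hβ0 (by nlinarith) (by nlinarith)
  have n₂ := min_listen_nonneg (t := 1 - γ * s) hγ0 hδ0 (by nlinarith) (by nlinarith)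
  have h₁ := mul_add_sub_one_le_min hs.le hα0 hα1 hβ1 (by linarith)
  have h₂ := mul_add_sub_one_le_min hs.le hγ0 hγ1 hδ1 (by linarith)
  have : α + β + γ + δ - 2 ≤ r / s := by
    rw [le_div_iff₀ hs]
    linarith
  linarith

/-- The outage exponents that are compatible with the receive-side orders `α`, `γ` and the listen
fractions `t₁`, `t₂` are bounded below by `0`. -/
theorem bddBelow_outage_exponents {r α γ t₁ t₂ : ℝ} (hα1 : α ≤ 1) (hγ1 : γ ≤ 1) :
    BddBelow {d : ℝ | ∃ β δ : ℝ, 0 ≤ β ∧ β ≤ 1 ∧ 0 ≤ δ ∧ δ ≤ 1 ∧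
      min (t₁ * α) ((1 - t₁) * β) + min (t₂ * γ) ((1 - t₂) * δ) ≤ r ∧
      d = 4 - α - β - γ - δ} := by
  refine ⟨0, ?_⟩
  rintro d ⟨β, δ, -, hβ1, -, hδ1, -, rfl⟩
  linarith

/-- A path with all-ones receive order carries at most `r` when its transmit-side order is
`r / (1 - r)`, whatever the listen fraction. -/
theorem min_listen_le {r t : ℝ} (hr0 : 0 ≤ r) (hr1 : r < 1) :
    min t ((1 - t) * (r / (1 - r))) ≤ r := by
  rcases le_total t r with h | h
  · exact min_le_of_left_le h
  · refine min_le_of_right_le ?_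
    have h1r : 0 < 1 - r := by linarith
    calc (1 - t) * (r / (1 - r)) ≤ (1 - r) * (r / (1 - r)) := by gcongr
      _ = r := by field_simp

/-- The optimal exponent for given receive-side orders is at least `2 - r / (1 - r)`. -/
theorem two_sub_div_le_sSup_outage {r α γ : ℝ} (hr0 : 0 ≤ r) (hr1 : r < 1)
    (hα0 : 0 ≤ α) (hα1 : α ≤ 1) (hγ0 : 0 ≤ γ) (hγ1 : γ ≤ 1) :
    2 - r / (1 - r) ≤ sSup {w : ℝ | ∃ t₁ t₂ : ℝ, 0 ≤ t₁ ∧ t₁ ≤ 1 ∧ 0 ≤ t₂ ∧ t₂ ≤ 1 ∧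
        w = sInf {d : ℝ | ∃ β δ : ℝ, 0 ≤ β ∧ β ≤ 1 ∧ 0 ≤ δ ∧ δ ≤ 1 ∧
          min (t₁ * α) ((1 - t₁) * β) + min (t₂ * γ) ((1 - t₂) * δ) ≤ r ∧
          d = 4 - α - β - γ - δ}} := by
  have h1r : 0 < 1 - r := by linarith
  have hfeas : ∀ t₁ t₂ : ℝ, min (t₁ * α) ((1 - t₁) * 0) + min (t₂ * γ) ((1 - t₂) * 0) ≤ r :=
    fun t₁ t₂ => by
      have h₁ := min_le_right (t₁ * α) ((1 - t₁) * 0)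
      have h₂ := min_le_right (t₂ * γ) ((1 - t₂) * 0)
      linarith
  have hlim : Filter.Tendsto (fun s : ℝ => 2 - r / s) (nhdsWithin (1 - r) (Set.Iio (1 - r)))
      (nhds (2 - r / (1 - r))) :=
    (ContinuousAt.sub continuousAt_const
      (ContinuousAt.div continuousAt_const continuousAt_id h1r.ne')).tendsto.mono_left
        nhdsWithin_le_nhds
  refine le_of_tendsto hlim ?_
  filter_upwards [Ioo_mem_nhdsLT h1r] with s ⟨hs, hrs⟩
  have hs1 : s ≤ 1 := by linarith
  refine le_csSup_of_le ⟨4, ?_⟩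
    ⟨1 - α * s, 1 - γ * s, by nlinarith, by nlinarith, by nlinarith, by nlinarith, rfl⟩
    (le_csInf ⟨_, 0, 0, le_rfl, zero_le_one, le_rfl, zero_le_one, hfeas _ _, rfl⟩ ?_)
  · rintro w ⟨t₁, t₂, -, -, -, -, rfl⟩
    exact csInf_le_of_le (bddBelow_outage_exponents hα1 hγ1)
      ⟨0, 0, le_rfl, zero_le_one, le_rfl, zero_le_one, hfeas _ _, rfl⟩ (by linarith)
  · rintro d ⟨β, δ, hβ0, hβ1, hδ0, hδ1, h, rfl⟩
    exact two_sub_div_le_of_outage hs hs1 hrs hα0 hα1 hγ0 hγ1 hβ0 hβ1 hδ0 hδ1 h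

/-- First part of Theorem 2: the optimal DMT of the half-duplex parallel relay
network with receive CSI for 0 ≤ r < 1/2, as an inf-sup-inf. -/
theorem parallel_DMT_receiveCSI (r : ℝ) (hr0 : 0 ≤ r) (hr1 : r < 1 / 2) :
    sInf {v : ℝ | ∃ α γ : ℝ, 0 ≤ α ∧ α ≤ 1 ∧ 0 ≤ γ ∧ γ ≤ 1 ∧
      v = sSup {w : ℝ | ∃ t₁ t₂ : ℝ, 0 ≤ t₁ ∧ t₁ ≤ 1 ∧ 0 ≤ t₂ ∧ t₂ ≤ 1 ∧
        w = sInf {d : ℝ | ∃ β δ : ℝ, 0 ≤ β ∧ β ≤ 1 ∧ 0 ≤ δ ∧ δ ≤ 1 ∧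
          min (t₁ * α) ((1 - t₁) * β) + min (t₂ * γ) ((1 - t₂) * δ) ≤ r ∧
          d = 4 - α - β - γ - δ}}} = 2 - r / (1 - r) := by
  have hr : r < 1 := by linarith
  have h1r : 0 < 1 - r := by linarith
  refine le_antisymm (csInf_le_of_le ⟨2 - r / (1 - r), ?_⟩
    ⟨1, 1, zero_le_one, le_rfl, zero_le_one, le_rfl, rfl⟩
    (csSup_le ⟨_, 0, 0, le_rfl, zero_le_one, le_rfl, zero_le_one, rfl⟩ ?_))
    (le_csInf ⟨_, 1, 1, zero_le_one, le_rfl, zero_le_one, le_rfl, rfl⟩ ?_)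
  · rintro v ⟨α, γ, hα0, hα1, hγ0, hγ1, rfl⟩
    exact two_sub_div_le_sSup_outage hr0 hr hα0 hα1 hγ0 hγ1
  · rintro w ⟨t₁, t₂, -, -, -, -, rfl⟩
    refine csInf_le_of_le (bddBelow_outage_exponents le_rfl le_rfl)
      ⟨r / (1 - r), 0, div_nonneg hr0 h1r.le, ?_, le_rfl, zero_le_one, ?_, rfl⟩ (by linarith)
    · rw [div_le_one h1r]
      linarith
    · have h₁ := min_listen_le (t := t₁) hr0 hr
      have h₂ := min_le_right (t₂ * 1) ((1 - t₂) * 0)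
      rw [mul_one t₁]
      linarith
  · rintro v ⟨α, γ, hα0, hα1, hγ0, hγ1, rfl⟩
    exact two_sub_div_le_sSup_outage hr0 hr hα0 hα1 hγ0 hγ1
end
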